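/- Let Φ ∈ ℝ^{m×N}, let S ⊆ {1,…,N} with |S| ≤ s, let x ∈ ℝ^N, e′ ∈ ℝ^m, and set y = Φx_S + e′. Let T ⊆ {1,…,N} with |T| = t where t > s, and let z_p be a least-squares solution over support T for data y. Suppose Φ satisfies the RIP of order s+t with constant δ₁ < 1 and the RIP of order t with constant δ₂. Let T_∇ ⊆ T be a set with |T_∇| = t − s such that |(z_p)_i| ≤ |(z_p)_j| for all i ∈ T_∇ and j ∈ T \ T_∇ (i.e., T_∇ consists of the indices of the t−s smallest magnitude entries of z_p in T). Then ‖(x_S)_{T_∇}‖₂ ≤ √2·δ₁·‖x_S − z_p‖₂ + √(2(1+δ₂))·‖e′‖₂. -/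

import Mathlib

open Matrix Finset

/-- The Euclidean norm of a vector in `ℝⁿ`. -/
noncomputable def norm2 {n : ℕ} (v : Fin n → ℝ) : ℝ := Real.sqrt (∑ i, (v i) ^ 2)

/-- The support of a vector: the set of indices of its nonzero entries. -/
noncomputable def supp {n : ℕ} (v : Fin n → ℝ) : Finset (Fin n) :=
  Finset.univ.filter (fun i => v i ≠ 0)

/-- `restrict v T` keeps the entries of `v` with indices in `T` and sets all others to zero. -/
def restrict {n : ℕ} (v : Fin n → ℝ) (T : Finset (Fin n)) : Fin n → ℝ :=
  fun i => if i ∈ T then v i else 0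

/-- `Φ` satisfies the restricted isometry property of order `t` with constant `δ`. -/
def RIP (m N : ℕ) (Φ : Matrix (Fin m) (Fin N) ℝ) (t : ℕ) (δ : ℝ) : Prop :=
  ∀ v : Fin N → ℝ, (supp v).card ≤ t →
    (1 - δ) * (norm2 v) ^ 2 ≤ (norm2 (Φ.mulVec v)) ^ 2 ∧
    (norm2 (Φ.mulVec v)) ^ 2 ≤ (1 + δ) * (norm2 v) ^ 2

/-- `z` is a least-squares solution over support `T` for data `y`. -/
def IsLeastSquares {m N : ℕ} (Φ : Matrix (Fin m) (Fin N) ℝ) (y : Fin m → ℝ)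
    (T : Finset (Fin N)) (z : Fin N → ℝ) : Prop :=
  supp z ⊆ T ∧ ∀ w : Fin N → ℝ, supp w ⊆ T →
    norm2 (y - Φ.mulVec z) ≤ norm2 (y - Φ.mulVec w)

/-- `U` is a set of indices of the `k` largest magnitude entries of `v`. -/
def IsLargest {n : ℕ} (v : Fin n → ℝ) (k : ℕ) (U : Finset (Fin n)) : Prop :=
  U.card = k ∧ ∀ i ∈ U, ∀ j ∉ U, |v j| ≤ |v i|

lemma norm2_nonneg {n : ℕ} (v : Fin n → ℝ) : 0 ≤ norm2 v := Real.sqrt_nonneg _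

lemma norm2_sq {n : ℕ} (v : Fin n → ℝ) : norm2 v ^ 2 = v ⬝ᵥ v := by
  unfold norm2
  rw [Real.sq_sqrt (Finset.sum_nonneg fun i _ => sq_nonneg _)]
  simp [dotProduct, pow_two]

lemma dot_le_norm2 {n : ℕ} (v w : Fin n → ℝ) : v ⬝ᵥ w ≤ norm2 v * norm2 w := by
  exact Real.sum_mul_le_sqrt_mul_sqrt _ _ _

lemma eq_zero_of_norm2 {n : ℕ} (v : Fin n → ℝ) (h : norm2 v = 0) : v = 0 := by
  have := norm2_sq v
  rw [h] at this
  exact dotProduct_self_eq_zero.mp (by linarith)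

lemma supp_subset_iff {n : ℕ} (v : Fin n → ℝ) (U : Finset (Fin n)) :
    supp v ⊆ U ↔ ∀ i, i ∉ U → v i = 0 := by
  simp only [supp, Finset.subset_iff, Finset.mem_filter, Finset.mem_univ, true_and]
  exact forall_congr' fun i => ⟨fun h hi => by_contra fun h' => hi (h h'),
    fun h h' => by_contra fun hi => h' (h hi)⟩

lemma rip_inner {m N : ℕ} (Φ : Matrix (Fin m) (Fin N) ℝ) (k : ℕ) (δ : ℝ)
    (h : RIP m N Φ k δ) (U : Finset (Fin N)) (hU : U.card ≤ k)
    (u w : Fin N → ℝ) (hu : supp u ⊆ U) (hw : supp w ⊆ U) :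
    u ⬝ᵥ w - (Φ *ᵥ u) ⬝ᵥ (Φ *ᵥ w) ≤ δ * (norm2 u * norm2 w) := by
  by_cases hu0 : norm2 u = 0
  · simp [eq_zero_of_norm2 u hu0, norm2]
  by_cases hw0 : norm2 w = 0
  · simp [eq_zero_of_norm2 w hw0, norm2]
  have hup : 0 < norm2 u := lt_of_le_of_ne (norm2_nonneg u) (Ne.symm hu0)
  have hwp : 0 < norm2 w := lt_of_le_of_ne (norm2_nonneg w) (Ne.symm hw0)
  have key : ∀ a b : ℝ, supp (a • u + b • w) ⊆ U := by
    intro a b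
    rw [supp_subset_iff] at *
    intro i hi
    simp [hu i hi, hw i hi]
  have h1 := (h _ ((Finset.card_le_card (key (norm2 w) (norm2 u))).trans hU)).1
  have h2 := (h _ ((Finset.card_le_card (key (norm2 w) (-norm2 u))).trans hU)).2
  simp only [norm2_sq, mulVec_add, mulVec_smul, dotProduct_add, add_dotProduct,
    dotProduct_smul, smul_dotProduct, smul_eq_mul] at h1 h2
  rw [dotProduct_comm w u, dotProduct_comm (Φ *ᵥ w) (Φ *ᵥ u)] at h1 h2
  simp only [← norm2_sq] at h1 h2
  have hp : 0 < norm2 u * norm2 w := mul_pos hup hwp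
  refine le_of_mul_le_mul_left ?_ hp
  nlinarith [h1, h2]

lemma ls_orth {m N : ℕ} (Φ : Matrix (Fin m) (Fin N) ℝ) (y : Fin m → ℝ)
    (T : Finset (Fin N)) (z : Fin N → ℝ) (h : IsLeastSquares Φ y T z)
    (w : Fin N → ℝ) (hw : supp w ⊆ T) : (y - Φ *ᵥ z) ⬝ᵥ (Φ *ᵥ w) = 0 := by
  obtain ⟨hz, h⟩ := h
  set c := (y - Φ *ᵥ z) ⬝ᵥ (Φ *ᵥ w) with hc
  have hq : ∀ a : ℝ, 0 ≤ - 2 * a * c + a ^ 2 * norm2 (Φ *ᵥ w) ^ 2 := by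
    intro a
    have hs : supp (z + a • w) ⊆ T := by
      rw [supp_subset_iff] at *
      intro i hi
      simp [hz i hi, hw i hi]
    have h1 := pow_le_pow_left₀ (norm2_nonneg _) (h _ hs) 2
    have e : y - Φ *ᵥ (z + a • w) = (y - Φ *ᵥ z) - a • (Φ *ᵥ w) := by
      rw [mulVec_add, mulVec_smul]; abel
    rw [e, norm2_sq, norm2_sq] at h1
    generalize y - Φ *ᵥ z = r at *
    simp only [dotProduct_sub, sub_dotProduct,
      dotProduct_smul, smul_dotProduct, smul_eq_mul] at h1
    rw [dotProduct_comm (Φ *ᵥ w) r, ← hc] at h1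
    rw [norm2_sq]
    nlinarith [h1]
  have hK := sq_nonneg (norm2 (Φ *ᵥ w))
  generalize norm2 (Φ *ᵥ w) ^ 2 = K at *
  have h1 := hq (c / (K + 1))
  have hK1 : 0 < K + 1 := by linarith
  have e : - 2 * (c / (K + 1)) * c + (c / (K + 1)) ^ 2 * K = - (c / (K + 1)) ^ 2 * (K + 2) := by
    field_simp; ring
  rw [e] at h1
  have : (c / (K + 1)) ^ 2 = 0 := by nlinarith [sq_nonneg (c / (K + 1))]
  have := pow_eq_zero_iff (two_ne_zero) |>.mp this
  rcases div_eq_zero_iff.mp this with h | h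
  · exact h
  · linarith

lemma sum_sq_le {N : ℕ} (z : Fin N → ℝ) (A B : Finset (Fin N)) (hc : A.card ≤ B.card)
    (h : ∀ i ∈ A, ∀ j ∈ B, |z i| ≤ |z j|) : ∑ i ∈ A, z i ^ 2 ≤ ∑ j ∈ B, z j ^ 2 := by
  rcases A.eq_empty_or_nonempty with rfl | hA
  · simpa using Finset.sum_nonneg fun i _ => sq_nonneg (z i)
  obtain ⟨k, hk, hmax⟩ := A.exists_max_image (fun i => z i ^ 2) hA
  calc ∑ i ∈ A, z i ^ 2 ≤ A.card • z k ^ 2 := Finset.sum_le_card_nsmul _ _ _ hmax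
    _ ≤ B.card • z k ^ 2 := by gcongr
    _ ≤ _ := Finset.card_nsmul_le_sum _ _ _ fun j hj => sq_le_sq.mpr (h k hk j hj)

lemma le_of_sq_le_sq_aux {a b : ℝ} (h : a ^ 2 ≤ b ^ 2) (hb : 0 ≤ b) : a ≤ b :=
  by nlinarith [h, hb]

theorem stmt_6 {m N : ℕ} (Φ : Matrix (Fin m) (Fin N) ℝ) (s t : ℕ) (hts : s < t)
    (S : Finset (Fin N)) (hS : S.card ≤ s)
    (x : Fin N → ℝ) (e' : Fin m → ℝ) (y : Fin m → ℝ)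
    (hy : y = Φ.mulVec (restrict x S) + e')
    (T : Finset (Fin N)) (hT : T.card = t)
    (zp : Fin N → ℝ) (hzp : IsLeastSquares Φ y T zp)
    (δ₁ δ₂ : ℝ) (hδ₁0 : 0 ≤ δ₁) (hδ₁1 : δ₁ < 1) (hδ₂0 : 0 ≤ δ₂) (hδ₂1 : δ₂ ≤ 1)
    (hRIP1 : RIP m N Φ (s + t) δ₁) (hRIP2 : RIP m N Φ t δ₂)
    (Tnab : Finset (Fin N)) (hsub : Tnab ⊆ T) (hcard : Tnab.card = t - s)
    (hsmall : ∀ i ∈ Tnab, ∀ j ∈ T \ Tnab, |zp i| ≤ |zp j|) :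
    norm2 (restrict (restrict x S) Tnab) ≤
      Real.sqrt 2 * δ₁ * norm2 (restrict x S - zp) +
        Real.sqrt (2 * (1 + δ₂)) * norm2 e' := by
  set xS := restrict x S with hxS
  set A := S ∩ Tnab with hA
  set B := (T \ Tnab) \ S with hB
  have hxS0 : ∀ i, i ∉ S → xS i = 0 := fun i hi => by simp [hxS, _root_.restrict, hi]
  have hz0 := (supp_subset_iff _ _).mp hzp.1
  set u := xS - zp with hu
  set w := restrict u (A ∪ B) with hw
  have hcardAB : A.card ≤ B.card := by
    have h1 : (T \ Tnab).card = s := by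
      rw [Finset.card_sdiff_of_subset hsub]; omega
    have h2 := Finset.card_sdiff_add_card_inter (T \ Tnab) S
    have h3 : A.card + ((T \ Tnab) ∩ S).card ≤ S.card := by
      rw [← Finset.card_union_of_disjoint]
      · apply Finset.card_le_card
        intro i; simp only [hA, Finset.mem_union, Finset.mem_inter]; tauto
      · rw [Finset.disjoint_left]
        intro i; simp only [hA, Finset.mem_inter, Finset.mem_sdiff]; tauto
    rw [← hB] at h2
    omega
  have hABd : Disjoint A B := by
    rw [Finset.disjoint_left]
    intro i; simp only [hA, hB, Finset.mem_inter, Finset.mem_sdiff]; tauto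
  have hz := sum_sq_le zp A B hcardAB (fun i hi j hj =>
    hsmall i (Finset.mem_inter.mp hi).2 j (Finset.mem_sdiff.mp hj).1)
  have hwT : supp w ⊆ T := by
    rw [supp_subset_iff]
    intro i hi
    have : i ∉ A ∪ B := by
      intro h
      simp only [hA, hB, Finset.mem_union, Finset.mem_inter, Finset.mem_sdiff] at h
      rcases h with h | h
      · exact hi (hsub h.2)
      · exact hi h.1.1
    simp [hw, _root_.restrict, this]
  have huST : supp u ⊆ S ∪ T := by
    rw [supp_subset_iff]
    intro i hi
    simp only [Finset.mem_union, not_or] at hi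
    simp [hu, hxS0 i hi.1, hz0 i hi.2]
  have hww : u ⬝ᵥ w = norm2 w ^ 2 := by
    rw [norm2_sq]
    unfold dotProduct
    refine Finset.sum_congr rfl fun i _ => ?_
    simp only [hw, _root_.restrict]; split_ifs <;> simp
  have hwsum : norm2 w ^ 2 = ∑ i ∈ A, u i ^ 2 + ∑ i ∈ B, u i ^ 2 := by
    rw [← Finset.sum_union hABd, norm2_sq]
    simp [-Finset.mem_union, dotProduct, hw, _root_.restrict, Finset.sum_ite_mem, ← pow_two]
  have hxsum : norm2 (restrict xS Tnab) ^ 2 = ∑ i ∈ A, xS i ^ 2 := by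
    have e : restrict xS Tnab = restrict xS A := by
      funext i
      by_cases hi : i ∈ S
      · simp [_root_.restrict, hA, hi]
      · simp [_root_.restrict, hxS0 i hi]
    rw [e, norm2_sq]
    simp [dotProduct, _root_.restrict, Finset.sum_ite_mem, ← pow_two]
  have hBu : ∑ i ∈ B, u i ^ 2 = ∑ i ∈ B, zp i ^ 2 := by
    refine Finset.sum_congr rfl fun i hi => ?_
    simp [hu, hxS0 i (Finset.mem_sdiff.mp hi).2]
  have hAx : ∑ i ∈ A, xS i ^ 2 ≤ 2 * ∑ i ∈ A, u i ^ 2 + 2 * ∑ i ∈ A, zp i ^ 2 := by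
    rw [Finset.mul_sum, Finset.mul_sum, ← Finset.sum_add_distrib]
    refine Finset.sum_le_sum fun i _ => ?_
    simp only [hu, Pi.sub_apply]
    nlinarith [sq_nonneg (xS i - 2 * zp i)]
  have hx2 : norm2 (restrict xS Tnab) ≤ Real.sqrt 2 * norm2 w := by
    refine le_of_sq_le_sq_aux ?_ (mul_nonneg (Real.sqrt_nonneg _) (norm2_nonneg _))
    rw [mul_pow, Real.sq_sqrt (by norm_num)]
    linarith
  have hri := rip_inner Φ (s + t) δ₁ hRIP1 (S ∪ T)
    ((Finset.card_union_le _ _).trans (by omega)) u w huST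
    (hwT.trans Finset.subset_union_right)
  have hor := ls_orth Φ y T zp hzp w hwT
  have ey : y - Φ *ᵥ zp = Φ *ᵥ u + e' := by
    rw [hy, hu, mulVec_sub]; abel
  rw [ey, add_dotProduct] at hor
  have hcs := dot_le_norm2 (-e') (Φ *ᵥ w)
  have hne : norm2 (-e') = norm2 e' := by simp [norm2]
  rw [hne, neg_dotProduct] at hcs
  have hPw : norm2 (Φ *ᵥ w) ≤ Real.sqrt (1 + δ₂) * norm2 w := by
    refine le_of_sq_le_sq_aux ?_ (mul_nonneg (Real.sqrt_nonneg _) (norm2_nonneg _))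
    rw [mul_pow, Real.sq_sqrt (by linarith)]
    exact (hRIP2 w ((Finset.card_le_card hwT).trans hT.le)).2
  have hfin : norm2 w ≤ δ₁ * norm2 u + Real.sqrt (1 + δ₂) * norm2 e' := by
    rcases (norm2_nonneg w).eq_or_lt with h0 | h0
    · rw [← h0]
      have := norm2_nonneg u
      have := norm2_nonneg e'
      positivity
    · have := mul_le_mul_of_nonneg_left hPw (norm2_nonneg e')
      refine le_of_mul_le_mul_right ?_ h0
      nlinarith
  calc _ ≤ Real.sqrt 2 * norm2 w := hx2
    _ ≤ Real.sqrt 2 * (δ₁ * norm2 u + Real.sqrt (1 + δ₂) * norm2 e') := by gcongr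
    _ = _ := by rw [Real.sqrt_mul (by norm_num)]; ring
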